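/- arXiv:1409.1279 — 2 statements merged into one kernel-verified Lean document; each statement's English description precedes it below -/
import Mathlib

section
/- Let μ be a finite measure on ℝ^d that is absolutely continuous with respect to Lebesgue measure and satisfies ∫‖x‖² dμ(x) < ∞, let p₁, …, p_k ∈ ℝ^d be pairwise distinct, and let ν₁, …, ν_k ∈ ℝ. Define g(W) = ∫ min_{1≤i≤k} (‖x − p_i‖² − w_i) dμ(x) + Σ_i ν_i w_i. If W* ∈ ℝ^k satisfies μ(Pow_{W*}(p_i)) = ν_i for all i (so that the gradient of g vanishes at W*), then W* is a global maximizer of g: g(W) ≤ g(W*) for all W ∈ ℝ^k. -/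
open MeasureTheory

/-- The power cell of `p i` for the weight vector `W`. -/
def powerCell {d k : ℕ} (p : Fin k → EuclideanSpace ℝ (Fin d)) (W : Fin k → ℝ)
    (i : Fin k) : Set (EuclideanSpace ℝ (Fin d)) :=
  {x | ∀ j : Fin k, j ≠ i → ‖x - p i‖ ^ 2 - W i < ‖x - p j‖ ^ 2 - W j}

/-- The radical hyperplane of two weighted points with distinct centres is Lebesgue-null. -/
lemma volume_radicalHyperplane {E : Type*} [NormedAddCommGroup E] [InnerProductSpace ℝ E]
    [FiniteDimensional ℝ E] [MeasurableSpace E] [BorelSpace E] {a b : E} (hab : a ≠ b)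
    (s t : ℝ) : volume {x : E | ‖x - a‖ ^ 2 - s = ‖x - b‖ ^ 2 - t} = 0 := by
  rcases Set.eq_empty_or_nonempty {x : E | ‖x - a‖ ^ 2 - s = ‖x - b‖ ^ 2 - t} with h | ⟨y, hy⟩
  · simp [h]
  have hne : AffineSubspace.mk' y (innerSL ℝ (a - b)).ker ≠ ⊤ := by
    intro h
    have hdir := congrArg AffineSubspace.direction h
    rw [AffineSubspace.direction_mk', AffineSubspace.direction_top] at hdir
    have hmem : a - b ∈ (innerSL ℝ (a - b)).ker := hdir ▸ Submodule.mem_top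
    exact hab (sub_eq_zero.1 ((inner_self_eq_zero (𝕜 := ℝ)).1 hmem))
  refine measure_mono_null (fun x hx => ?_) (Measure.addHaar_affineSubspace volume _ hne)
  simp only [Set.mem_ofPred_eq, norm_sub_sq_real] at hx hy
  simp only [SetLike.mem_coe, AffineSubspace.mem_mk', vsub_eq_sub, LinearMap.mem_ker,
    ContinuousLinearMap.coe_coe, innerSL_apply_apply, inner_sub_left, inner_sub_right]
  simp only [real_inner_comm] at hx hy ⊢
  linarith

lemma integrable_iInf_of_finite {α ι : Type*} [Finite ι] [MeasurableSpace α] {μ : Measure α}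
    {f : ι → α → ℝ} (hf : ∀ i, Integrable (f i) μ) : Integrable (fun x => ⨅ i, f i x) μ := by
  cases nonempty_fintype ι
  rcases isEmpty_or_nonempty ι with h | h
  · simp
  refine (integrable_finsetSum Finset.univ fun i _ => (hf i).abs).mono'
    (AEMeasurable.iInf fun i => (hf i).aemeasurable).aestronglyMeasurable
    (Filter.Eventually.of_forall fun x => ?_)
  obtain ⟨i, hi⟩ := exists_eq_ciInf_of_finite (f := fun i => f i x)
  rw [← hi, Real.norm_eq_abs]
  exact Finset.single_le_sum (f := fun i => |f i x|) (fun _ _ => abs_nonneg _) (Finset.mem_univ i)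

lemma integrable_norm_sub_sq {E : Type*} [NormedAddCommGroup E] [MeasurableSpace E]
    [BorelSpace E] [SecondCountableTopology E] {μ : Measure E} [IsFiniteMeasure μ]
    (h : Integrable (fun x => ‖x‖ ^ 2) μ) (a : E) : Integrable (fun x => ‖x - a‖ ^ 2) μ := by
  have hid : MemLp (fun x : E => x) 2 μ :=
    (memLp_two_iff_integrable_sq_norm aestronglyMeasurable_id).2 h
  exact (memLp_two_iff_integrable_sq_norm (by fun_prop)).1 (hid.sub (memLp_const a))

lemma measurableSet_powerCell {d k : ℕ} (p : Fin k → EuclideanSpace ℝ (Fin d)) (W : Fin k → ℝ)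
    (i : Fin k) : MeasurableSet (powerCell p W i) := by
  simp only [powerCell, Set.ofPred_forall]
  exact .iInter fun j => .iInter fun _ => measurableSet_lt (by fun_prop) (by fun_prop)

/-- Power cells are pairwise disjoint. -/
lemma eq_of_mem_powerCell {d k : ℕ} {p : Fin k → EuclideanSpace ℝ (Fin d)} {W : Fin k → ℝ}
    {i j : Fin k} {x : EuclideanSpace ℝ (Fin d)} (hi : x ∈ powerCell p W i)
    (hj : x ∈ powerCell p W j) : i = j := by
  by_contra h
  exact lt_asymm (hi j (Ne.symm h)) (hj i h)

/-- Power cells cover almost every point. -/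
lemma ae_exists_mem_powerCell {d k : ℕ} [Nonempty (Fin k)]
    {μ : Measure (EuclideanSpace ℝ (Fin d))} (hac : μ ≪ volume)
    {p : Fin k → EuclideanSpace ℝ (Fin d)} (hp : Function.Injective p) (W : Fin k → ℝ) :
    ∀ᵐ x ∂μ, ∃ i, x ∈ powerCell p W i := by
  have hne : ∀ᵐ x ∂μ, ∀ i j : Fin k, i ≠ j → ‖x - p i‖ ^ 2 - W i ≠ ‖x - p j‖ ^ 2 - W j := by
    simp only [ae_all_iff]
    intro i j hij
    refine measure_mono_null (fun x hx => ?_)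
      (hac (volume_radicalHyperplane (hp.ne hij) (W i) (W j)))
    simpa using hx
  filter_upwards [hne] with x hx
  obtain ⟨i, hi⟩ := Finite.exists_min fun i => ‖x - p i‖ ^ 2 - W i
  exact ⟨i, fun j hj => lt_of_le_of_ne (hi j) (hx i j hj.symm)⟩

/-- On the power cell of `p i`, the minimum of the power distances is attained at `i`. -/
lemma iInf_eq_of_mem_powerCell {d k : ℕ} {p : Fin k → EuclideanSpace ℝ (Fin d)}
    {W : Fin k → ℝ} {i : Fin k} {x : EuclideanSpace ℝ (Fin d)} (hx : x ∈ powerCell p W i) :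
    ⨅ j, (‖x - p j‖ ^ 2 - W j) = ‖x - p i‖ ^ 2 - W i := by
  have : Nonempty (Fin k) := ⟨i⟩
  refine le_antisymm (ciInf_le (Set.finite_range _).bddBelow i) (le_ciInf fun j => ?_)
  rcases eq_or_ne j i with rfl | hj
  · rfl
  · exact (hx j hj).le

/-- If at `W*` the measures of the power cells match the prescribed masses `ν_i`
(the gradient of `g` vanishes), then `W*` is a global maximizer of `g`. -/
theorem stationary_is_global_max
    (d k : ℕ) (μ : Measure (EuclideanSpace ℝ (Fin d))) [IsFiniteMeasure μ]
    (hac : μ ≪ volume) (hint : Integrable (fun x => ‖x‖ ^ 2) μ)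
    (p : Fin k → EuclideanSpace ℝ (Fin d)) (hp : Function.Injective p)
    (ν : Fin k → ℝ) (Wstar : Fin k → ℝ)
    (hstat : ∀ i : Fin k, (μ (powerCell p Wstar i)).toReal = ν i) :
    ∀ W : Fin k → ℝ,
      (∫ x, (⨅ i : Fin k, (‖x - p i‖ ^ 2 - W i)) ∂μ) + ∑ i : Fin k, ν i * W i ≤
      (∫ x, (⨅ i : Fin k, (‖x - p i‖ ^ 2 - Wstar i)) ∂μ) + ∑ i : Fin k, ν i * Wstar i := by
  intro W
  rcases isEmpty_or_nonempty (Fin k) with hk | hk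
  · simp
  have hF : ∀ V : Fin k → ℝ, Integrable (fun x => ⨅ i : Fin k, (‖x - p i‖ ^ 2 - V i)) μ :=
    fun V => integrable_iInf_of_finite fun i =>
      (integrable_norm_sub_sq hint (p i)).sub (integrable_const _)
  have hI : ∀ i ∈ Finset.univ, Integrable
      ((powerCell p Wstar i).indicator fun _ => Wstar i - W i) μ :=
    fun i _ => (integrable_const _).indicator (measurableSet_powerCell p Wstar i)
  have hle : ∀ᵐ x ∂μ, (⨅ i : Fin k, (‖x - p i‖ ^ 2 - W i)) ≤
      (⨅ i : Fin k, (‖x - p i‖ ^ 2 - Wstar i)) +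
        ∑ i, (powerCell p Wstar i).indicator (fun _ => Wstar i - W i) x := by
    filter_upwards [ae_exists_mem_powerCell hac hp Wstar] with x ⟨i, hi⟩
    rw [iInf_eq_of_mem_powerCell hi, Finset.sum_eq_single_of_mem i (Finset.mem_univ i)
      fun j _ hj => Set.indicator_of_notMem (fun h => hj (eq_of_mem_powerCell h hi)) _,
      Set.indicator_of_mem hi]
    have := ciInf_le (f := fun j => ‖x - p j‖ ^ 2 - W j) (Set.finite_range _).bddBelow i
    linarith
  have hmono := integral_mono_ae (hF W) ((hF Wstar).add (integrable_finsetSum _ hI)) hle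
  simp only [Pi.add_apply] at hmono
  rw [integral_add (hF Wstar) (integrable_finsetSum _ hI), integral_finsetSum _ hI] at hmono
  simp only [integral_indicator_const _ (measurableSet_powerCell p Wstar _), measureReal_def,
    hstat, smul_eq_mul, mul_sub, Finset.sum_sub_distrib] at hmono
  linarith
end

section
/- Let μ be a finite measure on ℝ^d that is absolutely continuous with respect to Lebesgue measure and satisfies ∫‖x‖² dμ(x) < ∞. Then the quantization noise power Q(Y) = ∫ min_{1≤i≤k} ‖x − y_i‖² dμ(x), viewed as a function of the point configuration Y = (y₁,…,y_k) ∈ (ℝ^d)^k, is differentiable at every Y with pairwise distinct points, and its gradient with respect to y_i is ∇_{y_i} Q(Y) = 2·(m_i · y_i − ∫_{Vor(y_i)} x dμ(x)) = 2 m_i (y_i − g_i), where m_i = μ(Vor(y_i)) and, when m_i > 0, g_i = (1/m_i) ∫_{Vor(y_i)} x dμ(x) is the centroid of the Voronoi cell of y_i. -/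
open MeasureTheory

/-- The Voronoi cell of `Y i`. -/
def voronoiCell {d k : ℕ} (Y : Fin k → EuclideanSpace ℝ (Fin d)) (i : Fin k) :
    Set (EuclideanSpace ℝ (Fin d)) :=
  {x | ∀ j : Fin k, j ≠ i → ‖x - Y i‖ ^ 2 < ‖x - Y j‖ ^ 2}

open Filter Topology

lemma abs_iInf_sub_iInf_le {ι : Type*} [Finite ι] [Nonempty ι] {f g : ι → ℝ} {C : ℝ}
    (h : ∀ i, |f i - g i| ≤ C) : |(⨅ i, f i) - ⨅ i, g i| ≤ C := by
  have hf := Set.finite_range f |>.bddBelow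
  have hg := Set.finite_range g |>.bddBelow
  rw [abs_sub_le_iff]
  constructor
  · rw [sub_le_comm]
    refine le_ciInf fun i => ?_
    linarith [ciInf_le hf i, (abs_le.1 (h i)).2]
  · rw [sub_le_comm]
    refine le_ciInf fun i => ?_
    linarith [ciInf_le hg i, (abs_le.1 (h i)).1]

lemma abs_norm_sub_sq_sub_norm_sub_sq_le {E : Type*} [NormedAddCommGroup E] (x a b : E) {R : ℝ}
    (ha : ‖a‖ ≤ R) (hb : ‖b‖ ≤ R) :
    |‖x - a‖ ^ 2 - ‖x - b‖ ^ 2| ≤ 2 * (‖x‖ + R) * ‖a - b‖ := by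
  have h1 : |‖x - a‖ - ‖x - b‖| ≤ ‖a - b‖ := by
    have := abs_norm_sub_norm_le (x - a) (x - b)
    rwa [sub_sub_sub_cancel_left, norm_sub_rev b a] at this
  have h2 : ‖x - a‖ + ‖x - b‖ ≤ 2 * (‖x‖ + R) := by
    linarith [norm_sub_le x a, norm_sub_le x b]
  rw [sq_sub_sq, abs_mul, abs_of_nonneg (by positivity : 0 ≤ ‖x - a‖ + ‖x - b‖)]
  exact mul_le_mul h2 h1 (abs_nonneg _) ((by positivity : (0 : ℝ) ≤ _).trans h2)

section

variable {d k : ℕ}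

lemma measurableSet_voronoiCell (Y : Fin k → EuclideanSpace ℝ (Fin d)) (i : Fin k) :
    MeasurableSet (voronoiCell Y i) := by
  unfold voronoiCell
  simp only [Set.ofPred_forall]
  refine MeasurableSet.iInter fun j => MeasurableSet.iInter fun _ => ?_
  exact measurableSet_lt (by fun_prop) (by fun_prop)

lemma ae_exists_mem_voronoiCell [Nonempty (Fin k)] {μ : Measure (EuclideanSpace ℝ (Fin d))}
    (hac : μ ≪ volume) {Y : Fin k → EuclideanSpace ℝ (Fin d)} (hY : Function.Injective Y) :
    ∀ᵐ x ∂μ, ∃ i, x ∈ voronoiCell Y i := by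
  have key : ∀ᵐ x ∂μ, ∀ i j : Fin k, i ≠ j → ‖x - Y i‖ ^ 2 ≠ ‖x - Y j‖ ^ 2 := by
    refine ae_all_iff.2 fun i => ae_all_iff.2 fun j => ?_
    by_cases hij : i = j
    · simp [hij]
    refine hac.ae_le ?_
    have h0 : volume (AffineSubspace.perpBisector (Y i) (Y j) :
        Set (EuclideanSpace ℝ (Fin d))) = 0 :=
      Measure.addHaar_affineSubspace _ _ (by simpa using hY.ne hij)
    filter_upwards [measure_eq_zero_iff_ae_notMem.1 h0] with x hx _ h
    apply hx
    rw [SetLike.mem_coe, AffineSubspace.mem_perpBisector_iff_dist_eq, dist_eq_norm, dist_eq_norm]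
    exact (sq_eq_sq₀ (norm_nonneg _) (norm_nonneg _)).1 h
  filter_upwards [key] with x hx
  obtain ⟨i, hi⟩ := Finite.exists_min fun i => ‖x - Y i‖ ^ 2
  exact ⟨i, fun j hj => lt_of_le_of_ne (hi j) (hx i j hj.symm)⟩

lemma notMem_voronoiCell_of_ne {Y : Fin k → EuclideanSpace ℝ (Fin d)} {i j : Fin k}
    {x : EuclideanSpace ℝ (Fin d)} (hx : x ∈ voronoiCell Y i) (hij : j ≠ i) :
    x ∉ voronoiCell Y j :=
  fun h => (hx j hij).asymm (h i hij.symm)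

lemma eventually_iInf_eq_of_mem_voronoiCell {Y : Fin k → EuclideanSpace ℝ (Fin d)} {i : Fin k}
    {x : EuclideanSpace ℝ (Fin d)} (hx : x ∈ voronoiCell Y i) :
    ∀ᶠ Z in 𝓝 Y, (⨅ j, ‖x - Z j‖ ^ 2) = ‖x - Z i‖ ^ 2 := by
  have h : ∀ᶠ Z in 𝓝 Y, ∀ j, j ≠ i → ‖x - Z i‖ ^ 2 < ‖x - Z j‖ ^ 2 := by
    refine eventually_all.2 fun j => ?_
    by_cases hj : j = i
    · simp [hj]
    have hc (l : Fin k) : ContinuousAt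
        (fun Z : Fin k → EuclideanSpace ℝ (Fin d) => ‖x - Z l‖ ^ 2) Y :=
      ((continuous_const.sub (continuous_apply l)).norm.pow 2).continuousAt
    filter_upwards [(hc i).eventually_lt (hc j) (hx j hj)] with Z hZ _ using hZ
  filter_upwards [h] with Z hZ
  have : Nonempty (Fin k) := ⟨i⟩
  refine le_antisymm (ciInf_le (Set.finite_range _).bddBelow i) (le_ciInf fun j => ?_)
  by_cases hj : j = i
  · rw [hj]
  · exact (hZ j hj).le

/-- The linear map sending `v` to the functional `Z ↦ ⟪v, Z i⟫`. -/
noncomputable def innerCoord (d : ℕ) {k : ℕ} (i : Fin k) : EuclideanSpace ℝ (Fin d) →L[ℝ]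
    (Fin k → EuclideanSpace ℝ (Fin d)) →L[ℝ] ℝ :=
  ((ContinuousLinearMap.compL ℝ (Fin k → EuclideanSpace ℝ (Fin d)) (EuclideanSpace ℝ (Fin d))
    ℝ).flip (ContinuousLinearMap.proj i)).comp (innerSL ℝ)

lemma innerCoord_apply (i : Fin k) (v : EuclideanSpace ℝ (Fin d))
    (Z : Fin k → EuclideanSpace ℝ (Fin d)) : innerCoord d i v Z = inner ℝ v (Z i) := rfl

lemma hasFDerivAt_norm_sub_coord_sq (Y : Fin k → EuclideanSpace ℝ (Fin d)) (i : Fin k)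
    (x : EuclideanSpace ℝ (Fin d)) :
    HasFDerivAt (fun Z : Fin k → EuclideanSpace ℝ (Fin d) => ‖x - Z i‖ ^ 2)
      (innerCoord d i ((2 : ℝ) • (Y i - x))) Y := by
  have h := ((hasFDerivAt_apply (𝕜 := ℝ) i Y).const_sub x).norm_sq
  refine h.congr_fderiv ?_
  ext v
  simp [innerCoord_apply]

lemma integrable_id_of_integrable_norm_sq {μ : Measure (EuclideanSpace ℝ (Fin d))}
    [IsFiniteMeasure μ] (hint : Integrable (fun x => ‖x‖ ^ 2) μ) :
    Integrable (fun x : EuclideanSpace ℝ (Fin d) => x) μ :=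
  ((memLp_two_iff_integrable_sq_norm (by fun_prop)).2 hint).integrable (by norm_num)

theorem hasFDerivAt_integral_iInf_norm_sub_sq {μ : Measure (EuclideanSpace ℝ (Fin d))}
    [IsFiniteMeasure μ] (hac : μ ≪ volume) (hint : Integrable (fun x => ‖x‖ ^ 2) μ)
    {Y : Fin k → EuclideanSpace ℝ (Fin d)} (hY : Function.Injective Y) :
    HasFDerivAt
      (fun Z : Fin k → EuclideanSpace ℝ (Fin d) => ∫ x, (⨅ i : Fin k, ‖x - Z i‖ ^ 2) ∂μ)
      (∑ i, innerCoord d i (∫ x in voronoiCell Y i, (2 : ℝ) • (Y i - x) ∂μ)) Y := by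
  rcases isEmpty_or_nonempty (Fin k) with hk | hk
  · simpa [Real.iInf_of_isEmpty] using hasFDerivAt_const (0 : ℝ) Y
  have hid := integrable_id_of_integrable_norm_sq hint
  let G (i : Fin k) : EuclideanSpace ℝ (Fin d) → EuclideanSpace ℝ (Fin d) :=
    (voronoiCell Y i).indicator fun x => (2 : ℝ) • (Y i - x)
  have hG (i : Fin k) : Integrable (G i) μ :=
    (((integrable_const _).sub hid).smul (2 : ℝ)).indicator (measurableSet_voronoiCell Y i)
  have hTG (i : Fin k) : Integrable (fun x => innerCoord d i (G i x)) μ :=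
    (innerCoord d i).integrable_comp (hG i)
  have hmeas (Z : Fin k → EuclideanSpace ℝ (Fin d)) :
      AEStronglyMeasurable (fun x => ⨅ i : Fin k, ‖x - Z i‖ ^ 2) μ :=
    (Measurable.iInf fun i => by fun_prop).aestronglyMeasurable
  have hderiv : HasFDerivAt
      (fun Z : Fin k → EuclideanSpace ℝ (Fin d) => ∫ x, (⨅ i : Fin k, ‖x - Z i‖ ^ 2) ∂μ)
      (∫ x, ∑ i, innerCoord d i (G i x) ∂μ) Y := by
    refine hasFDerivAt_integral_of_dominated_loc_of_lip
      (bound := fun x => 2 * (‖x‖ + (‖Y‖ + 1))) (Metric.ball_mem_nhds Y one_pos)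
      (Eventually.of_forall hmeas) ?_ (Finset.aestronglyMeasurable_fun_sum _ fun i _ => (hTG i).1)
      ?_ ?_ ?_ |>.2
    · obtain ⟨i₀⟩ := hk
      have hsq : Integrable (fun x => ‖x - Y i₀‖ ^ 2) μ :=
        (memLp_two_iff_integrable_sq_norm (by fun_prop)).1
          (((memLp_two_iff_integrable_sq_norm (by fun_prop)).2 hint).sub (memLp_const (Y i₀)))
      refine hsq.mono' (hmeas Y) (Eventually.of_forall fun x => ?_)
      rw [Real.norm_of_nonneg (Real.iInf_nonneg fun i => by positivity)]
      exact ciInf_le (Set.finite_range _).bddBelow i₀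
    · refine Eventually.of_forall fun x => LipschitzOnWith.of_dist_le_mul fun Z hZ W hW => ?_
      have hR {Z : Fin k → EuclideanSpace ℝ (Fin d)} (hZ : Z ∈ Metric.ball Y 1) (i : Fin k) :
          ‖Z i‖ ≤ ‖Y‖ + 1 := by
        have := norm_le_norm_add_norm_sub' Z Y
        rw [mem_ball_iff_norm] at hZ
        linarith [norm_le_pi_norm Z i]
      rw [Real.dist_eq, Real.coe_nnabs,
        abs_of_nonneg (by positivity : 0 ≤ 2 * (‖x‖ + (‖Y‖ + 1))), dist_eq_norm]
      refine abs_iInf_sub_iInf_le fun i =>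
        (abs_norm_sub_sq_sub_norm_sub_sq_le x _ _ (hR hZ i) (hR hW i)).trans ?_
      gcongr
      exact norm_le_pi_norm (Z - W) i
    · exact (hid.norm.add (integrable_const _)).const_mul 2
    · filter_upwards [ae_exists_mem_voronoiCell hac hY] with x ⟨i, hi⟩
      have hsum : ∑ j, innerCoord d j (G j x) = innerCoord d i ((2 : ℝ) • (Y i - x)) := by
        rw [Finset.sum_eq_single i]
        · simp only [G, Set.indicator_of_mem hi]
        · intro j _ hj
          simp only [G, Set.indicator_of_notMem (notMem_voronoiCell_of_ne hi hj), map_zero]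
        · simp
      rw [hsum]
      exact (hasFDerivAt_norm_sub_coord_sq Y i x).congr_of_eventuallyEq
        (eventually_iInf_eq_of_mem_voronoiCell hi)
  refine hderiv.congr_fderiv ?_
  rw [integral_finsetSum _ fun i _ => hTG i]
  refine Finset.sum_congr rfl fun i _ => ?_
  rw [(innerCoord d i).integral_comp_comm (hG i), integral_indicator (measurableSet_voronoiCell Y i)]

end

/-- The quantization noise power `Q(Y) = ∫ min_i ‖x − y_i‖² dμ` is differentiable at every
configuration `Y` of pairwise distinct points, and its gradient with respect to `y_i` is
`2 (m_i • y_i − ∫_{Vor(y_i)} x dμ) = 2 m_i (y_i − g_i)`. -/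
theorem quantization_noise_power_gradient
    (d k : ℕ) (μ : Measure (EuclideanSpace ℝ (Fin d))) [IsFiniteMeasure μ]
    (hac : μ ≪ volume) (hint : Integrable (fun x => ‖x‖ ^ 2) μ)
    (Y : Fin k → EuclideanSpace ℝ (Fin d)) (hY : Function.Injective Y) :
    DifferentiableAt ℝ
      (fun Z : Fin k → EuclideanSpace ℝ (Fin d) =>
        ∫ x, (⨅ i : Fin k, ‖x - Z i‖ ^ 2) ∂μ) Y ∧
    ∀ i : Fin k,
      HasGradientAt
        (fun z : EuclideanSpace ℝ (Fin d) =>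
          ∫ x, (⨅ j : Fin k, ‖x - Function.update Y i z j‖ ^ 2) ∂μ)
        ((2 * (μ (voronoiCell Y i)).toReal) • Y i -
          (2 : ℝ) • ∫ x in voronoiCell Y i, x ∂μ)
        (Y i) := by
  have hQ := hasFDerivAt_integral_iInf_norm_sub_sq hac hint hY
  refine ⟨hQ.differentiableAt, fun i => ?_⟩
  rw [hasGradientAt_iff_hasFDerivAt]
  have hid := (integrable_id_of_integrable_norm_sq hint).integrableOn (s := voronoiCell Y i)
  have hgrad : ∫ x in voronoiCell Y i, (2 : ℝ) • (Y i - x) ∂μ =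
      (2 * (μ (voronoiCell Y i)).toReal) • Y i - (2 : ℝ) • ∫ x in voronoiCell Y i, x ∂μ := by
    rw [integral_smul, integral_sub (integrable_const _) hid, setIntegral_const, smul_sub,
      smul_smul, Measure.real]
  rw [← hgrad]
  have hupd := hasFDerivAt_update (𝕜 := ℝ) Y (i := i) (Y i)
  rw [← Function.update_eq_self i Y] at hQ
  refine (hQ.comp (Y i) hupd).congr_fderiv ?_
  ext v
  simp only [Function.update_eq_self, ContinuousLinearMap.comp_apply,
    _root_.sum_apply, innerCoord_apply, InnerProductSpace.toDual_apply_apply]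
  rw [Finset.sum_eq_single i]
  · simp
  · intro j _ hj
    simp [hj]
  · simp
end
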